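/- arXiv:1912.08028 — 2 statements merged into one kernel-verified Lean document; each statement's English description precedes it below -/
import Mathlib

section
/- Let G be a finite simple graph containing edges xy and x'y' whose four endpoints x, y, x', y' are pairwise distinct, such that xx' is NOT an edge of G but each of xy', x'y, yy' is an edge of G (i.e., the crossing of xy and x'y' is almost full with missing pair xx'). Let G' be the graph obtained from G by deleting the edges xy and x'y' and adding a new vertex v adjacent exactly to x, y, x', y'. If G' has a Hamiltonian cycle that does not contain both of the edges vx and vx', then G has a Hamiltonian cycle. -/
open SimpleGraph

/-- The graph obtained from `G` by deleting the edges `xy` and `x'y'` and adding a new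
vertex (`none`) adjacent exactly to `x`, `y`, `x'`, `y'`. -/
def addCrossingVertex {V : Type*} (G : SimpleGraph V) (x y x' y' : V) :
    SimpleGraph (Option V) :=
  SimpleGraph.map Function.Embedding.some (G.deleteEdges {s(x, y), s(x', y')}) ⊔
    SimpleGraph.fromEdgeSet {s((none : Option V), some x), s(none, some y),
      s(none, some x'), s(none, some y')}

namespace SimpleGraph

/-- A path ending at `none` in a graph on `Option V` whose edges between old vertices all lie
in `G` is a path of `G` followed by one edge to `none`. -/
lemma Walk.IsPath.exists_walk_of_none {V : Type*} {G : SimpleGraph V}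
    {H : SimpleGraph (Option V)} (hHG : ∀ u w, H.Adj (some u) (some w) → G.Adj u w)
    {c d : Option V} (p : H.Walk c d) (hp : p.IsPath) (hd : d = none) (a : V) (hc : c = some a) :
    ∃ (b : V) (r : G.Walk a b),
      s(none, some b) ∈ p.edges ∧ p.support = r.support.map some ++ [none] := by
  induction p generalizing a with
  | nil => simp_all
  | @cons _ w _ h q ih =>
    subst hc hd
    rw [Walk.cons_isPath_iff] at hp
    cases w with
    | none =>
      obtain rfl := Walk.eq_nil_iff_nil.2 (Walk.isPath_iff_nil.1 hp.1)
      exact ⟨a, .nil, by simp [Sym2.eq_swap], by simp⟩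
    | some w =>
      obtain ⟨b, r, hb, hr⟩ := ih hp.1 rfl w rfl
      exact ⟨b, .cons (hHG _ _ h) r, by simp [hb], by simp [hr]⟩

/-- If `H` on `Option V` has a Hamiltonian cycle, its edges between old vertices all lie in `G`,
and the two cycle neighbours of `none` are always adjacent in `G`, then shortcutting `none`
yields a Hamiltonian cycle of `G`. -/
lemma Walk.IsHamiltonianCycle.exists_of_option {V : Type*} [Fintype V] [DecidableEq V]
    {G : SimpleGraph V} {H : SimpleGraph (Option V)}
    (hHG : ∀ u w, H.Adj (some u) (some w) → G.Adj u w) (hV : 2 < Fintype.card V)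
    {c : Option V} {p : H.Walk c c} (hp : p.IsHamiltonianCycle)
    (hG : ∀ a b, a ≠ b → s(none, some a) ∈ p.edges → s(none, some b) ∈ p.edges → G.Adj b a) :
    ∃ (a : V) (q : G.Walk a a), q.IsHamiltonianCycle := by
  have hn := hp.mem_support none
  have hrot := (Walk.isHamiltonianCycle_rotate hn).2 hp
  have hedges : ∀ e, e ∈ (p.rotate none hn).edges → e ∈ p.edges :=
    fun e => (p.rotate_edges none hn).mem_iff.1
  generalize p.rotate none hn = p' at hrot hedges
  cases p' with
  | nil => exact absurd rfl hrot.isCycle.ne_nil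
  | @cons _ u _ h q =>
    obtain ⟨hq, hnot⟩ := (Walk.cons_isCycle_iff q h).1 hrot.isCycle
    have hlen := hrot.length_eq
    cases u with
    | none => exact absurd h (H.loopless.irrefl _)
    | some a =>
      obtain ⟨b, r, hb, hr⟩ := hq.exists_walk_of_none hHG q rfl a rfl
      have hab : a ≠ b := by
        rintro rfl
        exact hnot hb
      have hadj : G.Adj b a := hG a b hab (hedges _ (by simp)) (hedges _ (by simp [hb]))
      have hrp : r.IsPath := by
        have := hq.support_nodup
        rw [hr] at this
        exact .mk' (this.of_append_left.of_map _)
      have hrl : r.length + 1 = Fintype.card V := by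
        have := congrArg List.length hr
        simp at this hlen
        omega
      refine ⟨b, .cons hadj r, Walk.isHamiltonianCycle_iff_isCycle_and_length_eq.2
        ⟨(Walk.cons_isCycle_iff r hadj).2 ⟨hrp, fun he => ?_⟩, by simpa using hrl⟩⟩
      have := hrp.length_eq_one_of_mem_edges (Sym2.eq_swap ▸ he)
      omega

end SimpleGraph

lemma addCrossingVertex_adj_some {V : Type*} {G : SimpleGraph V} {x y x' y' : V} (u w : V)
    (h : (addCrossingVertex G x y x' y').Adj (some u) (some w)) : G.Adj u w := by
  simp [addCrossingVertex, SimpleGraph.map_adj'] at h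
  tauto

lemma addCrossingVertex_adj_none {V : Type*} {G : SimpleGraph V} {x y x' y' : V} {u : V}
    (h : (addCrossingVertex G x y x' y').Adj none (some u)) :
    u = x ∨ u = y ∨ u = x' ∨ u = y' := by
  simpa [addCrossingVertex, SimpleGraph.map_adj'] using h

/-- If the crossing of `xy` and `x'y'` is almost full with missing pair `xx'`, and the graph
`G'` obtained by turning the crossing into a new 4-valent vertex `v = none` has a Hamiltonian
cycle not containing both edges `vx` and `vx'`, then `G` has a Hamiltonian cycle. -/
theorem almost_full_crossing_hamiltonian_cycle {V : Type*} [Fintype V] [DecidableEq V]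
    (G : SimpleGraph V) (x y x' y' : V)
    (hxy : x ≠ y) (hxx'ne : x ≠ x') (hxy' : x ≠ y') (hyx' : y ≠ x') (hyy' : y ≠ y')
    (hx'y' : x' ≠ y')
    (e1 : G.Adj x y) (e2 : G.Adj x' y')
    (hxx' : ¬ G.Adj x x') (f2 : G.Adj x y') (f3 : G.Adj y x') (f4 : G.Adj y y')
    (hham : ∃ (a : Option V) (p : (addCrossingVertex G x y x' y').Walk a a),
      p.IsHamiltonianCycle ∧
        ¬(s((none : Option V), some x) ∈ p.edges ∧ s((none : Option V), some x') ∈ p.edges)) :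
    ∃ (a : V) (p : G.Walk a a), p.IsHamiltonianCycle := by
  obtain ⟨c, p, hp, hnot⟩ := hham
  have hcard : 2 < Fintype.card V := by
    have := Finset.card_le_univ ({x, y, x'} : Finset V)
    rwa [Finset.card_eq_three.2 ⟨x, y, x', hxy, hxx'ne, hyx', rfl⟩] at this
  refine hp.exists_of_option addCrossingVertex_adj_some hcard fun a b hab ha hb => ?_
  have ha' := addCrossingVertex_adj_none (p.adj_of_mem_edges ha)
  have hb' := addCrossingVertex_adj_none (p.adj_of_mem_edges hb)
  rcases ha' with rfl | rfl | rfl | rfl <;> rcases hb' with rfl | rfl | rfl | rfl <;>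
    simp_all [SimpleGraph.adj_comm]
end

section
/- Let H be a finite simple graph that has a Hamiltonian cycle and let U be an independent set of vertices of H such that each vertex u ∈ U has pairwise adjacent neighbors in H (the neighborhood of each u ∈ U induces a complete subgraph), and suppose |V(H)| ≥ |U| + 3. Then the graph H − U obtained by deleting all vertices of U has a Hamiltonian cycle. -/
open SimpleGraph

/-- A path between two vertices outside an independent set of simplicial vertices can be
short-cut to a path avoiding that set and keeping all the other vertices. -/
theorem exists_isPath_induce_compl_of_simplicial {V : Type*} {H : SimpleGraph V} {U : Set V}
    (hindep : ∀ u ∈ U, ∀ w ∈ U, ¬H.Adj u w)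
    (hclique : ∀ u ∈ U, ∀ a b : V, H.Adj u a → H.Adj u b → a ≠ b → H.Adj a b) :
    ∀ {a b : V} (p : H.Walk a b) (_ : p.IsPath) (ha : a ∈ Uᶜ) (hb : b ∈ Uᶜ),
      ∃ q : (H.induce Uᶜ).Walk ⟨a, ha⟩ ⟨b, hb⟩,
        q.IsPath ∧ ∀ w : (Uᶜ : Set V), w ∈ q.support ↔ w.1 ∈ p.support
  | _, _, .nil, _, _, _ => ⟨.nil, .nil, fun w => by simp [Subtype.ext_iff]⟩
  | a, b, .cons (v := c) hac p, hp, ha, hb => by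
    rw [Walk.cons_isPath_iff] at hp
    by_cases hc : c ∈ U
    · cases p with
      | nil => exact absurd hc hb
      | @cons _ d _ hcd p =>
        rw [Walk.cons_isPath_iff] at hp
        have hd : d ∈ Uᶜ := fun hd => hindep c hc d hd hcd
        have hap : a ∉ p.support := fun h => hp.2 (by simp [h])
        have hne : a ≠ d := fun h => hap (h ▸ p.start_mem_support)
        have had := hclique c hc a d hac.symm hcd hne
        obtain ⟨q, hq, hqs⟩ :=
          exists_isPath_induce_compl_of_simplicial hindep hclique p hp.1.1 hd hb
        have hadj : (H.induce Uᶜ).Adj ⟨a, ha⟩ ⟨d, hd⟩ := had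
        refine ⟨.cons hadj q, (Walk.cons_isPath_iff _ _).2 ⟨hq, fun h => hap ((hqs _).1 h)⟩, ?_⟩
        intro w
        have hwc : w.1 ≠ c := fun h => w.2 (h ▸ hc)
        simp [hqs, Subtype.ext_iff, hwc]
    · obtain ⟨q, hq, hqs⟩ := exists_isPath_induce_compl_of_simplicial hindep hclique p hp.1 hc hb
      have hadj : (H.induce Uᶜ).Adj ⟨a, ha⟩ ⟨c, hc⟩ := hac
      refine ⟨.cons hadj q, (Walk.cons_isPath_iff _ _).2 ⟨hq, fun h => hp.2 ((hqs _).1 h)⟩, ?_⟩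
      intro w
      simp [hqs, Subtype.ext_iff]
  termination_by _ _ p => p.length

/-- Closing up a Hamiltonian path of length at least two gives a Hamiltonian cycle. -/
theorem SimpleGraph.Walk.IsHamiltonian.isHamiltonianCycle_cons {V : Type*} [DecidableEq V]
    {G : SimpleGraph V} {a b : V} {p : G.Walk b a} (hp : p.IsHamiltonian) (h : G.Adj a b)
    (hlen : 2 ≤ p.length) : (Walk.cons h p).IsHamiltonianCycle := by
  refine Walk.isHamiltonianCycle_iff_isCycle_and_support_count_tail_eq_one.2
    ⟨(Walk.cons_isCycle_iff _ _).2 ⟨hp.isPath, fun he => ?_⟩, fun v => by simpa using hp v⟩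
  have hpath := hp.isPath
  cases p with
  | nil => simp at hlen
  | @cons _ c _ hbc p =>
    rw [Walk.cons_isPath_iff] at hpath
    rw [Walk.edges_cons, List.mem_cons] at he
    rcases he with he | he
    · have hca : a = c := by
        rcases Sym2.eq_iff.1 he with ⟨h1, -⟩ | ⟨h1, -⟩
        · exact absurd h1 h.ne
        · exact h1
      subst hca
      have := Walk.length_eq_zero_iff.2 (Walk.isPath_iff_nil.1 hpath.1)
      simp [this] at hlen
    · exact hpath.2 (p.snd_mem_support_of_mem_edges he)

/-- If `H` has a Hamiltonian cycle, `U` is an independent set of vertices each of whose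
neighborhoods induces a complete subgraph, and `H` has at least `|U| + 3` vertices, then
`H − U` has a Hamiltonian cycle. -/
theorem delete_independent_simplicial_set_hamiltonian {V : Type*} [Fintype V] [DecidableEq V]
    (H : SimpleGraph V) (U : Finset V)
    (hindep : ∀ u ∈ U, ∀ w ∈ U, ¬H.Adj u w)
    (hclique : ∀ u ∈ U, ∀ a b : V, H.Adj u a → H.Adj u b → a ≠ b → H.Adj a b)
    (hcard : U.card + 3 ≤ Fintype.card V)
    (hham : ∃ (a : V) (p : H.Walk a a), p.IsHamiltonianCycle) :
    ∃ (a : ((↑U : Set V)ᶜ : Set V)) (p : (H.induce ((↑U : Set V)ᶜ)).Walk a a),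
      p.IsHamiltonianCycle := by
  obtain ⟨a₀, p₀, hp₀⟩ := hham
  obtain ⟨a, ha⟩ : ∃ a, a ∉ U := by
    by_contra! h
    have := Finset.card_eq_iff_eq_univ U |>.2 (Finset.eq_univ_iff_forall.2 h)
    omega
  have hcardc : Fintype.card ((↑U : Set V)ᶜ : Set V) = Fintype.card V - U.card := by
    rw [Fintype.card_compl_set]; simp
  -- It suffices to find a path covering the complement of `U` whose ends are adjacent.
  suffices h : ∃ (c : V) (p : H.Walk c a), p.IsPath ∧ c ∉ U ∧ H.Adj a c ∧
      ∀ w, w ∉ U → w ∈ p.support by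
    obtain ⟨c, p, hp, hc, hac, hw⟩ := h
    obtain ⟨q, hq, hqs⟩ := exists_isPath_induce_compl_of_simplicial (U := (U : Set V))
      hindep hclique p hp hc ha
    have hqh : q.IsHamiltonian := hq.isHamiltonian_of_mem fun w => (hqs w).2 (hw w w.2)
    have hadj : (H.induce ((U : Set V)ᶜ)).Adj ⟨a, ha⟩ ⟨c, hc⟩ := hac
    refine ⟨_, _, hqh.isHamiltonianCycle_cons hadj ?_⟩
    rw [hqh.length_eq, hcardc]
    omega
  have hp := hp₀.rotate (hp₀.mem_support a)
  generalize p₀.rotate a (hp₀.mem_support a) = p at hp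
  have hlen := hp.isCycle.three_le_length
  have htail := hp.isHamiltonian_tail
  match p, hlen, htail with
  | .cons (v := s) has p, hlen, htail =>
    replace htail : p.IsHamiltonian := by simpa [Walk.IsHamiltonian] using htail
    by_cases hs : s ∈ U
    · match p, hlen, htail with
      | .nil, hlen, _ => simp at hlen
      | .cons (v := c) hsc p, hlen, htail =>
        have hpath := ((Walk.cons_isPath_iff _ _).1 htail.isPath).1
        have hne : a ≠ c := by
          rintro rfl
          have := Walk.length_eq_zero_iff.2 (Walk.isPath_iff_nil.1 hpath)
          simp [this] at hlen
        refine ⟨c, p, hpath, fun hc => hindep s hs c hc hsc,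
          hclique s hs a c has.symm hsc hne, fun w hw => ?_⟩
        have := htail.mem_support w
        rw [Walk.support_cons, List.mem_cons] at this
        exact this.resolve_left fun h => hw (h ▸ hs)
    · exact ⟨s, p, htail.isPath, hs, has, fun w _ => htail.mem_support w⟩
end
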